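/- Let R be a ring, M an R-module, and M₁, …, Mₛ submodules of M such that M is their internal direct sum. Assume each Mᵢ is a semisimple R-module, and that for all i ≠ j no simple submodule of Mᵢ is isomorphic as an R-module to a submodule of Mⱼ. Then every R-linear endomorphism f : M → M satisfies f(Mᵢ) ⊆ Mᵢ for every i. -/

import Mathlib

/-- A linear map out of a semisimple module vanishes when no simple submodule of its source is
isomorphic to a submodule of its target. -/
theorem LinearMap.eq_zero_of_isEmpty_simple_equiv {R N P : Type*} [Ring R]
    [AddCommGroup N] [Module R N] [AddCommGroup P] [Module R P] [IsSemisimpleModule R N]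
    (h : ∀ A : Submodule R N, IsSimpleModule R A → ∀ B : Submodule R P, IsEmpty (A ≃ₗ[R] B))
    (g : N →ₗ[R] P) : g = 0 := by
  rw [← LinearMap.ker_eq_top, eq_top_iff, ← IsSemisimpleModule.sSup_simples_eq_top R N]
  refine sSup_le fun A (hA : IsSimpleModule R A) ↦ ?_
  rcases (g.domRestrict A).injective_or_eq_zero with hinj | hzero
  · exact ((h A hA _).false (LinearEquiv.ofInjective _ hinj)).elim
  · exact fun a ha ↦ LinearMap.congr_fun hzero ⟨a, ha⟩

/-- Schur-type invariance: Let `M` be the internal direct sum of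
submodules `M₁, …, Mₛ`, each semisimple, such that for `i ≠ j` no simple submodule of
`Mᵢ` is isomorphic to a submodule of `Mⱼ`. Then every `R`-linear endomorphism `f` of `M`
satisfies `f(Mᵢ) ⊆ Mᵢ` for every `i`. -/
theorem statement12 (R : Type*) [Ring R] (M : Type*) [AddCommGroup M] [Module R M]
    (s : ℕ) (p : Fin s → Submodule R M)
    (hint : DirectSum.IsInternal p)
    (hss : ∀ i, IsSemisimpleModule R (p i))
    (hdisj : ∀ i j : Fin s, i ≠ j →
      ∀ A : Submodule R (p i), IsSimpleModule R A →
        ∀ B : Submodule R (p j), IsEmpty (A ≃ₗ[R] B))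
    (f : M →ₗ[R] M) :
    ∀ i : Fin s, (p i).map f ≤ p i := by
  rintro i _ ⟨x, hx, rfl⟩
  have := hss i
  let e := LinearEquiv.ofBijective (DirectSum.coeLinearMap p) hint
  have hcomp : ∀ j, j ≠ i → e.symm (f x) j = 0 := fun j hji ↦
    LinearMap.congr_fun (LinearMap.eq_zero_of_isEmpty_simple_equiv (hdisj i j hji.symm)
      (DirectSum.component R (Fin s) (fun j ↦ p j) j ∘ₗ e.symm.toLinearMap ∘ₗ
        f ∘ₗ (p i).subtype)) ⟨x, hx⟩
  have hof : e.symm (f x) = DirectSum.lof R (Fin s) (fun j ↦ p j) i (e.symm (f x) i) := by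
    ext j : 1
    by_cases hji : j = i
    · subst hji
      exact (DirectSum.lof_apply (M := fun j ↦ p j) R j _).symm
    · rw [hcomp j hji]
      exact (DirectSum.of_eq_of_ne (β := fun j ↦ p j) _ _ _ hji).symm
  have hfx : f x = e.symm (f x) i := by
    rw [← DirectSum.coeLinearMap_lof p i (e.symm (f x) i), ← hof]
    exact (e.apply_symm_apply (f x)).symm
  exact hfx ▸ (e.symm (f x) i).2
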